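/- Assume relations (R1), (R2) and (R3) hold in R. Then for all 1 ≤ i < j ≤ n+1 and all 1 ≤ s < t ≤ n+1 one has e_{i,j}·e_{s,t}^N = B(i,j;s,t)^N·e_{s,t}^N·e_{i,j}, i.e. the commutator [e_{i,j}, e_{s,t}^N]_c (with scalar B(i,j;s,t)^N) vanishes. (Lemma 'commutationN'.) -/

import Mathlib

/-- `B(i,j;p,r) = ∏_{i≤ℓ≤j−1} ∏_{p≤h≤r−1} q_{ℓ,h}`. -/
def Bq {k : Type*} [Field k] (qm : ℕ → ℕ → k) (i j p r : ℕ) : k :=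
  ∏ l ∈ Finset.Ico i j, ∏ h ∈ Finset.Ico p r, qm l h

/-- The iterated braided commutators `e_{i,j}`: `e_{i,i+1} = x_i` and
`e_{i,j} = e_{i,j−1}·e_{j−1,j} − B(i,j−1;j−1,j)·e_{j−1,j}·e_{i,j−1}` for `j − i ≥ 2`. -/
def ee {k R : Type*} [Field k] [Ring R] [Algebra k R]
    (qm : ℕ → ℕ → k) (x : ℕ → R) : ℕ → ℕ → R
  | i, j =>
    if _ : j ≤ i + 1 then x i
    else
      ee qm x i (j - 1) * ee qm x (j - 1) j
        - Bq qm i (j - 1) (j - 1) j • (ee qm x (j - 1) j * ee qm x i (j - 1))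
  termination_by i j => j - i
  decreasing_by all_goals omega

/-- `a` and `b` commute up to the scalar `α`: `a * b = α • (b * a)`. -/
def QComm {k R : Type*} [Field k] [Ring R] [Algebra k R] (α : k) (a b : R) : Prop :=
  a * b = α • (b * a)

/-- The braiding matrix `qm` is of Cartan type `A_n` with parameter `q`. -/
structure IsCartanTypeA {k : Type*} [Field k] (n : ℕ) (q : k) (qm : ℕ → ℕ → k) : Prop where
  ne_zero : ∀ i j, 1 ≤ i → i ≤ n → 1 ≤ j → j ≤ n → qm i j ≠ 0
  diag : ∀ i, 1 ≤ i → i ≤ n → qm i i = q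
  adj : ∀ i j, 1 ≤ i → i ≤ n → 1 ≤ j → j ≤ n → (i = j + 1 ∨ j = i + 1) →
    qm i j * qm j i = q⁻¹
  far : ∀ i j, 1 ≤ i → i ≤ n → 1 ≤ j → j ≤ n → (i + 2 ≤ j ∨ j + 2 ≤ i) →
    qm i j * qm j i = 1

/-- The elements `x i`, `1 ≤ i ≤ n`, satisfy the quantum Serre relations of type `A_n`. -/
structure QuantumSerre {k R : Type*} [Field k] [Ring R] [Algebra k R]
    (n : ℕ) (qm : ℕ → ℕ → k) (x : ℕ → R) : Prop where
  far : ∀ i p, 1 ≤ i → i < p → p ≤ n → i + 2 ≤ p → QComm (qm i p) (x i) (x p)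
  left : ∀ i, 1 ≤ i → i < n →
    QComm (Bq qm i (i + 1) i (i + 2)) (ee qm x i (i + 1)) (ee qm x i (i + 2))
  right : ∀ i, 1 ≤ i → i < n →
    QComm (Bq qm i (i + 2) (i + 1) (i + 2)) (ee qm x i (i + 2)) (ee qm x (i + 1) (i + 2))

section QComm

variable {k R : Type*} [Field k] [Ring R] [Algebra k R] {α β : k} {a b c : R}

theorem QComm.mul_right (hb : QComm α a b) (hc : QComm β a c) : QComm (α * β) a (b * c) := by
  unfold QComm at *
  rw [← mul_assoc, hb, smul_mul_assoc, mul_assoc, hc, mul_smul_comm, smul_smul, mul_assoc]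

theorem QComm.mul_left (ha : QComm α a c) (hb : QComm β b c) : QComm (α * β) (a * b) c := by
  unfold QComm at *
  rw [mul_assoc, hb, mul_smul_comm, ← mul_assoc, ha, smul_mul_assoc, smul_smul, mul_assoc,
    mul_comm β]

theorem QComm.smul_right (γ : k) (h : QComm α a b) : QComm α a (γ • b) := by
  unfold QComm at *
  rw [mul_smul_comm, h, smul_mul_assoc, smul_comm]

theorem QComm.smul_left (γ : k) (h : QComm α a b) : QComm α (γ • a) b := by
  unfold QComm at *
  rw [mul_smul_comm, smul_mul_assoc, h, smul_comm]

theorem QComm.bracket_right (γ : k) (hb : QComm α a b) (hc : QComm β a c) :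
    QComm (α * β) a (b * c - γ • (c * b)) := by
  have h := hb.mul_right hc
  have h' := (hc.mul_right hb).smul_right γ
  rw [mul_comm β] at h'
  unfold QComm at *
  rw [mul_sub, sub_mul, smul_sub, h, h']

theorem QComm.bracket_left (γ : k) (ha : QComm α a c) (hb : QComm β b c) :
    QComm (α * β) (a * b - γ • (b * a)) c := by
  have h := ha.mul_left hb
  have h' := (hb.mul_left ha).smul_left γ
  rw [mul_comm β] at h'
  unfold QComm at *
  rw [mul_sub, sub_mul, smul_sub, h, h']

theorem QComm.symm (h : QComm α a b) (hαβ : β * α = 1) : QComm β b a := by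
  unfold QComm at *
  rw [h, smul_smul, hαβ, one_smul]

/-- The braided Jacobi identity `[[a, b], c] = [a, [b, c]]`, valid when `[a, c] = 0`. -/
theorem bracket_assoc (χab χbc χac : k) (hac : QComm χac a c) :
    (a * b - χab • (b * a)) * c - (χac * χbc) • (c * (a * b - χab • (b * a)))
      = a * (b * c - χbc • (c * b)) - (χab * χac) • ((b * c - χbc • (c * b)) * a) := by
  unfold QComm at hac
  have h1 : a * (c * b) = χac • (c * (a * b)) := by
    rw [← mul_assoc, hac, smul_mul_assoc, mul_assoc]
  simp only [mul_sub, sub_mul, mul_smul_comm, smul_mul_assoc, mul_assoc, h1, hac]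
  module

theorem qcomm_middle {q χ12 χ13 χ23 : k} {x₁ x₂ x₃ e13 e24 e14 : R}
    (hq : 1 + q ≠ 0) (hχ : χ23 ≠ 0)
    (h13 : e13 = x₁ * x₂ - χ12 • (x₂ * x₁)) (h24 : e24 = x₂ * x₃ - χ23 • (x₃ * x₂))
    (h14 : e14 = e13 * x₃ - (χ13 * χ23) • (x₃ * e13))
    (h14' : e14 = x₁ * e24 - (χ12 * χ13) • (e24 * x₁))
    (hl : QComm (χ12 * q) e13 x₂) (hr : QComm (q * χ23) x₂ e24) :
    QComm (χ12 * χ23⁻¹) e14 x₂ := by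
  unfold QComm at *
  have A : e13 * e24 = (χ12 * q) • (x₂ * e14) - χ23 • (e14 * x₂)
      + (χ12 * q * χ13 * χ23) • (e24 * e13) := by
    have t1 : e13 * (x₂ * x₃) = (χ12 * q) • (x₂ * (e13 * x₃)) := by
      rw [← mul_assoc, hl, smul_mul_assoc, mul_assoc]
    rw [h14, h24]
    simp only [mul_sub, sub_mul, mul_smul_comm, smul_mul_assoc, mul_assoc, t1, hl]
    module
  have B : e13 * e24 = (q * χ23) • (e14 * x₂) - χ12 • (x₂ * e14)
      + (χ12 * q * χ13 * χ23) • (e24 * e13) := by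
    have t1 : x₂ * (e24 * x₁) = (q * χ23) • (e24 * (x₂ * x₁)) := by
      rw [← mul_assoc, hr, smul_mul_assoc, mul_assoc]
    rw [h14', h13]
    simp only [mul_sub, sub_mul, mul_smul_comm, smul_mul_assoc, mul_assoc, t1, hr]
    module
  have C : ((1 + q) * χ23) • (e14 * x₂) = ((1 + q) * χ12) • (x₂ * e14) := by
    linear_combination (norm := module) A - B
  have D := congrArg (fun y => ((1 + q) * χ23)⁻¹ • y) C
  simp only [smul_smul] at D
  rw [inv_mul_cancel₀ (mul_ne_zero hq hχ), one_smul] at D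
  rw [D]
  congr 1
  field_simp

theorem mul_pow_eq_of_bracket {q χ : k} (h : a * b = χ • (b * a) + c)
    (hc : QComm (χ * q) c b) (m : ℕ) :
    a * b ^ (m + 1) = χ ^ (m + 1) • (b ^ (m + 1) * a)
      + (χ ^ m * ∑ l ∈ Finset.range (m + 1), q ^ l) • (b ^ m * c) := by
  induction m with
  | zero => simp [h]
  | succ m ih =>
    have hc' : c * b = (χ * q) • (b * c) := hc
    rw [pow_succ b (m + 1), ← mul_assoc, ih, add_mul, smul_mul_assoc, smul_mul_assoc,
      mul_assoc _ a b, mul_assoc _ c b, h, hc', geom_sum_succ (n := m + 1), mul_add,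
      mul_smul_comm, mul_smul_comm, ← mul_assoc, ← mul_assoc, ← pow_succ, ← pow_succ]
    module

theorem pow_mul_eq_of_bracket {q χ : k} (h : a * b = χ • (b * a) + c)
    (hc : QComm (χ * q) a c) (m : ℕ) :
    a ^ (m + 1) * b = χ ^ (m + 1) • (b * a ^ (m + 1))
      + (χ ^ m * ∑ l ∈ Finset.range (m + 1), q ^ l) • (c * a ^ m) := by
  induction m with
  | zero => simp [h]
  | succ m ih =>
    have hc' : a * c = (χ * q) • (c * a) := hc
    rw [pow_succ' a (m + 1), mul_assoc, ih, mul_add, mul_smul_comm, mul_smul_comm,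
      ← mul_assoc a b, ← mul_assoc a c, h, hc', geom_sum_succ (n := m + 1), add_mul,
      smul_mul_assoc, smul_mul_assoc, mul_assoc, mul_assoc, ← pow_succ', ← pow_succ']
    module

/-- At a primitive `N`-th root of unity the `N`-th powers of both factors of a bracket that is
itself `q`-central for them are central up to a scalar. -/
theorem qcomm_pow_of_bracket {q χ : k} {N : ℕ} (hN : 1 < N) (hq : IsPrimitiveRoot q N)
    (h : a * b = χ • (b * a) + c) (hl : QComm (χ * q) a c) (hr : QComm (χ * q) c b) :
    QComm (χ ^ N) a (b ^ N) ∧ QComm (χ ^ N) (a ^ N) b := by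
  obtain ⟨m, rfl⟩ : ∃ m, N = m + 1 := ⟨N - 1, by omega⟩
  unfold QComm
  rw [mul_pow_eq_of_bracket h hr, pow_mul_eq_of_bracket h hl, hq.geom_sum_eq_zero hN]
  simp

end QComm

section Bq

variable {k : Type*} [Field k] {n N : ℕ} {q : k} {qm : ℕ → ℕ → k}

theorem Bq_mul_left (qm : ℕ → ℕ → k) {i j m : ℕ} (p r : ℕ) (hij : i ≤ j) (hjm : j ≤ m) :
    Bq qm i j p r * Bq qm j m p r = Bq qm i m p r :=
  Finset.prod_Ico_consecutive _ hij hjm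

theorem Bq_mul_right (qm : ℕ → ℕ → k) (i j : ℕ) {p r m : ℕ} (hpr : p ≤ r) (hrm : r ≤ m) :
    Bq qm i j p r * Bq qm i j r m = Bq qm i j p m := by
  simp only [Bq, ← Finset.prod_mul_distrib, Finset.prod_Ico_consecutive _ hpr hrm]

theorem prod_Bq_left (qm : ℕ → ℕ → k) (i j s t : ℕ) :
    ∏ p ∈ Finset.Ico s t, Bq qm p (p + 1) i j = Bq qm s t i j := by
  simp [Bq]

theorem prod_Bq_right (qm : ℕ → ℕ → k) (i j s t : ℕ) :
    ∏ p ∈ Finset.Ico s t, Bq qm i j p (p + 1) = Bq qm i j s t := by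
  simp only [Bq, Nat.Ico_succ_singleton, Finset.prod_singleton]
  exact Finset.prod_comm

theorem Bq_mul_Bq_comm (qm : ℕ → ℕ → k) (i j s t : ℕ) :
    Bq qm i j s t * Bq qm s t i j
      = ∏ l ∈ Finset.Ico i j, ∏ h ∈ Finset.Ico s t, qm l h * qm h l := by
  unfold Bq
  rw [Finset.prod_comm (s := Finset.Ico s t), ← Finset.prod_mul_distrib]
  simp only [Finset.prod_mul_distrib]

namespace IsCartanTypeA

variable (H : IsCartanTypeA n q qm)
include H

theorem Bq_ne_zero {i j s t : ℕ} (hi : 1 ≤ i) (hj : j ≤ n + 1) (hs : 1 ≤ s) (ht : t ≤ n + 1) :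
    Bq qm i j s t ≠ 0 := by
  refine Finset.prod_ne_zero_iff.2 fun l hl => Finset.prod_ne_zero_iff.2 fun h hh => ?_
  rw [Finset.mem_Ico] at hl hh
  exact H.ne_zero _ _ (by omega) (by omega) (by omega) (by omega)

theorem Bq_mul_Bq_far {i j s t : ℕ} (hi : 1 ≤ i) (hjs : j < s) (ht : t ≤ n + 1) :
    Bq qm i j s t * Bq qm s t i j = 1 := by
  rw [Bq_mul_Bq_comm]
  refine Finset.prod_eq_one fun l hl => Finset.prod_eq_one fun h hh => ?_
  rw [Finset.mem_Ico] at hl hh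
  exact H.far _ _ (by omega) (by omega) (by omega) (by omega) (by omega)

theorem Bq_mul_Bq_adj {i j t : ℕ} (hi : 1 ≤ i) (hij : i < j) (hjt : j < t) (ht : t ≤ n + 1) :
    Bq qm i j j t * Bq qm j t i j = q⁻¹ := by
  obtain ⟨m, rfl⟩ : ∃ m, j = m + 1 := ⟨j - 1, by omega⟩
  have h1 := H.Bq_mul_Bq_far (j := m) hi (Nat.lt_succ_self m) ht
  have h2 := H.Bq_mul_Bq_far (i := m) (j := m + 1) (s := m + 1 + 1) (by omega) (by omega) ht
  have h3 := H.adj m (m + 1) (by omega) (by omega) (by omega) (by omega) (by omega)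
  have e : ∀ a b, Bq qm a (a + 1) b (b + 1) = qm a b := by simp [Bq]
  rw [← e m, ← e (m + 1)] at h3
  rw [← Bq_mul_left qm (m + 1) t (Nat.le_of_lt_succ hij) (Nat.le_succ m),
    ← Bq_mul_right qm (m + 1) t (Nat.le_of_lt_succ hij) (Nat.le_succ m),
    ← Bq_mul_right qm m (m + 1) (Nat.le_succ (m + 1)) hjt,
    ← Bq_mul_left qm m (m + 1) (Nat.le_succ (m + 1)) hjt]
  simp only [Nat.succ_eq_add_one] at *
  linear_combination (Bq qm m (m + 1) (m + 1) (m + 1 + 1) * Bq qm m (m + 1) (m + 1 + 1) t *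
    (Bq qm (m + 1) (m + 1 + 1) m (m + 1) * Bq qm (m + 1 + 1) t m (m + 1))) * h1 +
    Bq qm m (m + 1) (m + 1) (m + 1 + 1) * Bq qm (m + 1) (m + 1 + 1) m (m + 1) * h2 + h3

theorem Bq_self (hq : q ≠ 0) {i j : ℕ} (hi : 1 ≤ i) (hij : i < j) (hj : j ≤ n + 1) :
    Bq qm i j i j = q := by
  induction j, hij using Nat.le_induction with
  | base => simpa [Bq] using H.diag i hi (by omega)
  | succ j hij ih =>
    have h1 := H.Bq_mul_Bq_adj hi hij (Nat.lt_succ_self j) hj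
    have h2 : Bq qm j (j + 1) j (j + 1) = q := by
      simpa [Bq] using H.diag j (by omega) (by omega)
    have hij' : i ≤ j := Nat.le_of_lt hij
    rw [← Bq_mul_left qm i (j + 1) hij' (Nat.le_succ j),
      ← Bq_mul_right qm i j hij' (Nat.le_succ j),
      ← Bq_mul_right qm j (j + 1) hij' (Nat.le_succ j)]
    simp only [Nat.succ_eq_add_one] at *
    rw [ih (by omega), h2]
    have h3 : q * q⁻¹ = 1 := mul_inv_cancel₀ hq
    linear_combination q ^ 2 * h1 + q * h3

theorem Bq_pow_mul_Bq_pow (hq : q ^ N = 1) {i j s t : ℕ} (hi : 1 ≤ i) (hj : j ≤ n + 1)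
    (hs : 1 ≤ s) (ht : t ≤ n + 1) : Bq qm i j s t ^ N * Bq qm s t i j ^ N = 1 := by
  rw [← mul_pow, Bq_mul_Bq_comm, ← Finset.prod_pow]
  refine Finset.prod_eq_one fun l hl => ?_
  rw [← Finset.prod_pow]
  refine Finset.prod_eq_one fun h hh => ?_
  rw [Finset.mem_Ico] at hl hh
  have hl' : 1 ≤ l ∧ l ≤ n := by omega
  have hh' : 1 ≤ h ∧ h ≤ n := by omega
  by_cases h0 : l = h
  · subst h0
    rw [H.diag l hl'.1 hl'.2, mul_pow, hq, one_mul]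
  · by_cases h1 : l = h + 1 ∨ h = l + 1
    · rw [H.adj l h hl'.1 hl'.2 hh'.1 hh'.2 h1, inv_pow, hq, inv_one]
    · rw [H.far l h hl'.1 hl'.2 hh'.1 hh'.2 (by omega), one_pow]

end IsCartanTypeA

end Bq

section Roots

variable {k R : Type*} [Field k] [Ring R] [Algebra k R] {n : ℕ} {q : k} {qm : ℕ → ℕ → k}
  {x : ℕ → R}

theorem ee_succ_self (qm : ℕ → ℕ → k) (x : ℕ → R) (i : ℕ) : ee qm x i (i + 1) = x i := by
  rw [ee]; simp

theorem ee_succ (qm : ℕ → ℕ → k) (x : ℕ → R) {i j : ℕ} (h : i < j) :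
    ee qm x i (j + 1) = ee qm x i j * x j - Bq qm i j j (j + 1) • (x j * ee qm x i j) := by
  rw [ee, dif_neg (by omega), Nat.add_sub_cancel, ee_succ_self]

theorem qcomm_ee_right {y : R} {f : ℕ → k} {s t : ℕ} (hst : s < t)
    (h : ∀ p, s ≤ p → p < t → QComm (f p) y (x p)) :
    QComm (∏ p ∈ Finset.Ico s t, f p) y (ee qm x s t) := by
  induction t, hst using Nat.le_induction with
  | base => simpa [ee_succ_self] using h s le_rfl (Nat.lt_succ_self s)
  | succ t hst ih =>
    rw [ee_succ qm x hst, Finset.prod_Ico_succ_top (Nat.le_of_lt hst)]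
    exact (ih fun p hp hpt => h p hp (by omega)).bracket_right _
      (h t (Nat.le_of_lt hst) (Nat.lt_succ_self t))

theorem qcomm_ee_left {y : R} {f : ℕ → k} {s t : ℕ} (hst : s < t)
    (h : ∀ p, s ≤ p → p < t → QComm (f p) (x p) y) :
    QComm (∏ p ∈ Finset.Ico s t, f p) (ee qm x s t) y := by
  induction t, hst using Nat.le_induction with
  | base => simpa [ee_succ_self] using h s le_rfl (Nat.lt_succ_self s)
  | succ t hst ih =>
    rw [ee_succ qm x hst, Finset.prod_Ico_succ_top (Nat.le_of_lt hst)]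
    exact (ih fun p hp hpt => h p hp (by omega)).bracket_left _
      (h t (Nat.le_of_lt hst) (Nat.lt_succ_self t))

namespace QuantumSerre

variable (S : QuantumSerre n qm x)
include S

theorem qcomm_ee_far {i j s t : ℕ} (hi : 1 ≤ i) (hij : i < j) (hjs : j < s) (hst : s < t)
    (ht : t ≤ n + 1) : QComm (Bq qm i j s t) (ee qm x i j) (ee qm x s t) := by
  rw [← prod_Bq_left]
  refine qcomm_ee_left hij fun l hl hlj => ?_
  rw [← prod_Bq_right]
  refine qcomm_ee_right hst fun p hp hpt => ?_
  simpa [Bq] using S.far l p (by omega) (by omega) (by omega) (by omega)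

theorem ee_bracket_adj {i j t : ℕ} (hi : 1 ≤ i) (hij : i < j) (hjt : j < t) (ht : t ≤ n + 1) :
    ee qm x i t = ee qm x i j * ee qm x j t - Bq qm i j j t • (ee qm x j t * ee qm x i j) := by
  induction t, hjt using Nat.le_induction with
  | base => rw [ee_succ qm x hij, ee_succ_self]
  | succ t hjt ih =>
    have hjt' : j < t := hjt
    have hc := S.qcomm_ee_far hi hij hjt' (Nat.lt_succ_self t) ht
    rw [ee_succ_self] at hc
    rw [ee_succ qm x (hij.trans hjt'), ee_succ qm x hjt', ih (by omega),
      ← Bq_mul_left qm t (t + 1) (Nat.le_of_lt hij) (Nat.le_of_lt hjt'),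
      ← Bq_mul_right qm i j (Nat.le_of_lt hjt') (Nat.le_succ t)]
    exact bracket_assoc _ _ _ hc

theorem qcomm_first {i j : ℕ} (hi : 1 ≤ i) (hij : i + 2 ≤ j) (hj : j ≤ n + 1) :
    QComm (Bq qm i (i + 1) i j) (x i) (ee qm x i j) := by
  have h2 := S.left i hi (by omega)
  rw [ee_succ_self] at h2
  obtain rfl | hlt := hij.eq_or_lt
  · exact h2
  · have h3 := S.qcomm_ee_far hi (Nat.lt_succ_self i) (Nat.lt_succ_self (i + 1)) hlt hj
    rw [ee_succ_self] at h3
    rw [S.ee_bracket_adj hi (by omega : i < i + 2) hlt hj,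
      ← Bq_mul_right qm i (i + 1) (by omega : i ≤ i + 2) hij]
    exact h2.bracket_right _ h3

theorem qcomm_last {i j : ℕ} (hi : 1 ≤ i) (hij : i < j) (hj : j ≤ n) :
    QComm (Bq qm i (j + 1) j (j + 1)) (ee qm x i (j + 1)) (x j) := by
  obtain ⟨m, rfl⟩ : ∃ m, j = m + 1 := ⟨j - 1, by omega⟩
  have h2 := S.right m (by omega) (by omega)
  rw [ee_succ_self] at h2
  obtain rfl | hlt := (Nat.le_of_lt_succ hij).eq_or_lt
  · exact h2
  · have h3 := S.qcomm_ee_far hi hlt (Nat.lt_succ_self m) (Nat.lt_succ_self (m + 1))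
      (by omega)
    rw [ee_succ_self] at h3
    rw [S.ee_bracket_adj hi hlt (by omega : m < m + 1 + 1) (by omega),
      ← Bq_mul_left qm (m + 1) (m + 1 + 1) (Nat.le_of_lt hlt) (by omega : m ≤ m + 1 + 1)]
    exact h3.bracket_left _ h2

variable (H : IsCartanTypeA n q qm)
include H

theorem qcomm_inner (hq0 : q ≠ 0) (hq1 : 1 + q ≠ 0) {i m j : ℕ} (hi : 1 ≤ i) (him : i < m)
    (hmj : m + 1 < j) (hj : j ≤ n + 1) :
    QComm (Bq qm i j m (m + 1)) (ee qm x i j) (x m) := by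
  have hm : m < m + 1 := Nat.lt_succ_self m
  have hχ : Bq qm m (m + 1) (m + 1) j ≠ 0 := H.Bq_ne_zero (by omega) (by omega) (by omega) hj
  have hself : Bq qm m (m + 1) m (m + 1) = q := H.Bq_self hq0 (by omega) hm (by omega)
  have hadj := H.Bq_mul_Bq_adj (by omega : 1 ≤ m) hm hmj hj
  have key := qcomm_middle (q := q) (χ12 := Bq qm i m m (m + 1)) (χ13 := Bq qm i m (m + 1) j)
    (χ23 := Bq qm m (m + 1) (m + 1) j) (x₁ := ee qm x i m) (x₂ := x m)
    (x₃ := ee qm x (m + 1) j) (e13 := ee qm x i (m + 1)) (e24 := ee qm x m j)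
    (e14 := ee qm x i j) hq1 hχ (ee_succ qm x him)
    (by rw [S.ee_bracket_adj (by omega) hm hmj hj, ee_succ_self])
    (by rw [Bq_mul_left qm _ _ him.le hm.le, ← S.ee_bracket_adj hi (by omega) hmj hj])
    (by rw [Bq_mul_right qm _ _ hm.le hmj.le, ← S.ee_bracket_adj hi him (by omega) hj])
    (by
      rw [← hself, Bq_mul_left qm _ _ him.le hm.le]
      exact S.qcomm_last hi him (by omega))
    (by
      rw [← hself, Bq_mul_right qm _ _ hm.le hmj.le]
      exact S.qcomm_first (by omega) (by omega) hj)
  convert key using 1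
  rw [← Bq_mul_left qm _ _ him.le (by omega : m ≤ j), ← Bq_mul_left qm _ _ hm.le hmj.le, hself]
  field_simp at hadj ⊢
  linear_combination Bq qm i m m (m + 1) * hadj

theorem qcomm_ee_nested_right (hq0 : q ≠ 0) (hq1 : 1 + q ≠ 0) {i j s t : ℕ} (hi : 1 ≤ i)
    (his : i < s) (hst : s < t) (htj : t ≤ j) (hj : j ≤ n + 1) :
    QComm (Bq qm i j s t) (ee qm x i j) (ee qm x s t) := by
  rw [← prod_Bq_right]
  refine qcomm_ee_right hst fun p hp hpt => ?_
  obtain rfl | hlt : p + 1 = j ∨ p + 1 < j := by omega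
  · exact S.qcomm_last hi (by omega) (by omega)
  · exact S.qcomm_inner H hq0 hq1 hi (by omega) hlt hj

theorem qcomm_ee_nested_left (hq0 : q ≠ 0) (hq1 : 1 + q ≠ 0) {i j t : ℕ} (hi : 1 ≤ i)
    (hij : i < j) (hjt : j < t) (ht : t ≤ n + 1) :
    QComm (Bq qm i j i t) (ee qm x i j) (ee qm x i t) := by
  rw [← prod_Bq_left]
  refine qcomm_ee_left hij fun p hp hpj => ?_
  obtain rfl | hlt := hp.eq_or_lt
  · exact S.qcomm_first hi (by omega) ht
  · refine (S.qcomm_inner H hq0 hq1 hi hlt (by omega) ht).symm ?_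
    have hp1 : p ≤ p + 1 := Nat.le_succ p
    have hself : Bq qm p (p + 1) p (p + 1) = q := H.Bq_self hq0 (by omega) (by omega) (by omega)
    have h1 := H.Bq_mul_Bq_adj hi hlt (Nat.lt_succ_self p) (by omega)
    have h2 := H.Bq_mul_Bq_adj (by omega : 1 ≤ p) (Nat.lt_succ_self p) (by omega : p + 1 < t) ht
    simp only [Nat.succ_eq_add_one] at h1 h2
    rw [← Bq_mul_right qm p (p + 1) hlt.le (by omega : p ≤ t),
      ← Bq_mul_right qm p (p + 1) hp1 (by omega : p + 1 ≤ t),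
      ← Bq_mul_left qm p (p + 1) hlt.le (by omega : p ≤ t),
      ← Bq_mul_left qm p (p + 1) hp1 (by omega : p + 1 ≤ t), hself]
    have h3 : q * q⁻¹ = 1 := mul_inv_cancel₀ hq0
    linear_combination q ^ 2 * (Bq qm p (p + 1) (p + 1) t * Bq qm (p + 1) t p (p + 1)) * h1
      + q ^ 2 * q⁻¹ * h2 + (q * q⁻¹ + 1) * h3

/-- The bracket of two root vectors `e_{i,j}`, `e_{s,t}` with `(i, j) < (s, t)` lexicographically
commutes up to a scalar with each of them. -/
theorem exists_bracket (hq0 : q ≠ 0) (hq1 : 1 + q ≠ 0) {i j s t : ℕ} (hi : 1 ≤ i)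
    (hij : i < j) (hj : j ≤ n + 1) (hst : s < t) (ht : t ≤ n + 1)
    (h : i < s ∨ i = s ∧ j < t) :
    ∃ c : R, ee qm x i j * ee qm x s t
        = Bq qm i j s t • (ee qm x s t * ee qm x i j) + c ∧
      QComm (Bq qm i j s t * q) (ee qm x i j) c ∧
      QComm (Bq qm i j s t * q) c (ee qm x s t) := by
  have of_qcomm (hc : QComm (Bq qm i j s t) (ee qm x i j) (ee qm x s t)) :
      ∃ c : R, ee qm x i j * ee qm x s t
        = Bq qm i j s t • (ee qm x s t * ee qm x i j) + c ∧
      QComm (Bq qm i j s t * q) (ee qm x i j) c ∧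
      QComm (Bq qm i j s t * q) c (ee qm x s t) :=
    ⟨0, by rw [add_zero]; exact hc, by simp [QComm], by simp [QComm]⟩
  obtain his | ⟨rfl, hjt⟩ := h
  swap
  · exact of_qcomm (S.qcomm_ee_nested_left H hq0 hq1 hi hij hjt ht)
  obtain htj | hjt := le_or_gt t j
  · exact of_qcomm (S.qcomm_ee_nested_right H hq0 hq1 hi his hst htj hj)
  have hselfij : Bq qm i j i j = q := H.Bq_self hq0 hi hij hj
  have hselfst : Bq qm s t s t = q := H.Bq_self hq0 (by omega) hst ht
  have hleft : QComm (q * Bq qm i j j t) (ee qm x i j) (ee qm x i t) := by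
    rw [← hselfij, Bq_mul_right qm _ _ hij.le hjt.le]
    exact S.qcomm_ee_nested_left H hq0 hq1 hi hij hjt ht
  have hright : QComm (Bq qm i s s t * q) (ee qm x i t) (ee qm x s t) := by
    rw [← hselfst, Bq_mul_left qm _ _ his.le hst.le]
    exact S.qcomm_ee_nested_right H hq0 hq1 hi his hst le_rfl ht
  obtain hjs | rfl | hsj := lt_trichotomy j s
  · exact of_qcomm (S.qcomm_ee_far hi hij hjs hst ht)
  · refine ⟨ee qm x i t, ?_, ?_, hright⟩
    · rw [S.ee_bracket_adj hi hij hst ht]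
      abel
    · rwa [mul_comm]
  · have hs : 1 ≤ s := by omega
    have hselfsj : Bq qm s j s j = q := H.Bq_self hq0 hs hsj hj
    have hb : QComm (Bq qm s j s t) (ee qm x s j) (ee qm x s t) :=
      S.qcomm_ee_nested_left H hq0 hq1 hs hsj hjt ht
    have ha : QComm (Bq qm i j s j) (ee qm x i j) (ee qm x s j) :=
      S.qcomm_ee_nested_right H hq0 hq1 hi his hsj le_rfl hj
    have hm : QComm (Bq qm i t s j) (ee qm x i t) (ee qm x s j) :=
      S.qcomm_ee_nested_right H hq0 hq1 hi his hsj hjt.le ht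
    refine ⟨(Bq qm s j s t * Bq qm i t s j - Bq qm i s s j) • (ee qm x s j * ee qm x i t),
      ?_, ?_, ?_⟩
    · have hm' : ee qm x i t * ee qm x s j = Bq qm i t s j • (ee qm x s j * ee qm x i t) := hm
      have hb' : ee qm x s j * ee qm x s t
          = Bq qm s j s t • (ee qm x s t * ee qm x s j) := hb
      have hit := S.ee_bracket_adj hi his hst ht
      have e1 : ee qm x i s * ee qm x s t
          = ee qm x i t + Bq qm i s s t • (ee qm x s t * ee qm x i s) := by
        rw [hit]; abel
      have e2 : ee qm x i s * (ee qm x s t * ee qm x s j)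
          = ee qm x i t * ee qm x s j
            + Bq qm i s s t • (ee qm x s t * (ee qm x i s * ee qm x s j)) := by
        rw [← mul_assoc, e1, add_mul, smul_mul_assoc, mul_assoc]
      have e3 : ee qm x s j * (ee qm x s t * ee qm x i s)
          = Bq qm s j s t • (ee qm x s t * (ee qm x s j * ee qm x i s)) := by
        rw [← mul_assoc, hb', smul_mul_assoc, mul_assoc]
      rw [S.ee_bracket_adj hi his hsj hj, ← Bq_mul_left qm s t his.le hsj.le]
      simp only [mul_sub, sub_mul, mul_smul_comm, smul_mul_assoc, mul_assoc, hb', e1, e2, e3,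
        hm', mul_add, smul_add, smul_sub]
      module
    · have := (ha.mul_right hleft).smul_right
        (Bq qm s j s t * Bq qm i t s j - Bq qm i s s j)
      rwa [mul_left_comm, Bq_mul_right qm _ _ hsj.le hjt.le, mul_comm] at this
    · have := (hb.mul_left hright).smul_left
        (Bq qm s j s t * Bq qm i t s j - Bq qm i s s j)
      rwa [← mul_assoc, mul_comm (Bq qm s j s t), Bq_mul_left qm _ _ his.le hsj.le] at this

end QuantumSerre

end Roots

/-- Lemma `commutationN`: `e_{i,j}·e_{s,t}^N = B(i,j;s,t)^N·e_{s,t}^N·e_{i,j}` for all `i < j`, `s < t`. -/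
theorem commutationN {k R : Type*} [Field k] [Ring R] [Algebra k R]
    (n N : ℕ) (hn : 1 ≤ n) (hN : 2 < N) (q : k) (hq : IsPrimitiveRoot q N)
    (qm : ℕ → ℕ → k)
    (hqne : ∀ i j, 1 ≤ i → i ≤ n → 1 ≤ j → j ≤ n → qm i j ≠ 0)
    (hdiag : ∀ i, 1 ≤ i → i ≤ n → qm i i = q)
    (hadj : ∀ i j, 1 ≤ i → i ≤ n → 1 ≤ j → j ≤ n → (i = j + 1 ∨ j = i + 1) →
      qm i j * qm j i = q⁻¹)
    (hfar : ∀ i j, 1 ≤ i → i ≤ n → 1 ≤ j → j ≤ n → (i + 2 ≤ j ∨ j + 2 ≤ i) →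
      qm i j * qm j i = 1)
    (x : ℕ → R)
    (R1 : ∀ i p, 1 ≤ i → i < p → p ≤ n → i + 2 ≤ p →
      x i * x p = qm i p • (x p * x i))
    (R2 : ∀ i, 1 ≤ i → i < n →
      ee qm x i (i+1) * ee qm x i (i+2)
        = Bq qm i (i+1) i (i+2) • (ee qm x i (i+2) * ee qm x i (i+1)))
    (R3 : ∀ i, 1 ≤ i → i < n →
      ee qm x i (i+2) * ee qm x (i+1) (i+2)
        = Bq qm i (i+2) (i+1) (i+2) • (ee qm x (i+1) (i+2) * ee qm x i (i+2)))
    : ∀ i j s t, 1 ≤ i → i < j → j ≤ n + 1 → 1 ≤ s → s < t → t ≤ n + 1 →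
      ee qm x i j * ee qm x s t ^ N
        = (Bq qm i j s t ^ N) • (ee qm x s t ^ N * ee qm x i j) := by
  have H : IsCartanTypeA n q qm := ⟨hqne, hdiag, hadj, hfar⟩
  have S : QuantumSerre n qm x := ⟨R1, R2, R3⟩
  have hq0 : q ≠ 0 := hq.ne_zero (by omega)
  have hq1 : 1 + q ≠ 0 := fun h => hq.pow_ne_one_of_pos_of_lt (l := 2) two_ne_zero hN (by
    rw [eq_neg_of_add_eq_zero_right h]; norm_num)
  intro i j s t hi hij hj hs hst ht
  by_cases hlt : i < s ∨ i = s ∧ j < t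
  · obtain ⟨c, h, hl, hr⟩ := S.exists_bracket H hq0 hq1 hi hij hj hst ht hlt
    exact (qcomm_pow_of_bracket (by omega) hq h hl hr).1
  by_cases hgt : s < i ∨ s = i ∧ t < j
  · obtain ⟨c, h, hl, hr⟩ := S.exists_bracket H hq0 hq1 hs hst ht hij hj hgt
    exact (qcomm_pow_of_bracket (by omega) hq h hl hr).2.symm
      (H.Bq_pow_mul_Bq_pow hq.pow_eq_one hi hj hs ht)
  obtain ⟨rfl, rfl⟩ : i = s ∧ j = t := by omega
  rw [H.Bq_self hq0 hi hij hj, hq.pow_eq_one, one_smul, ← pow_succ, ← pow_succ']
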